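/- arXiv:1501.06075 — 6 statements merged into one kernel-verified Lean document; each statement's English description precedes it below -/
import Mathlib

section
/- The function H : ℕ → ℕ given by H(n) = f^n(n) (the n-th iterate of f applied to n) is completely multiplicative: H(1) = 1 and H(mn) = H(m)·H(n) for all positive integers m and n (not necessarily coprime). -/
/-- The iterates of `f` starting at `n` eventually reach `1`. -/
def ReachesOne (f : ℕ → ℕ) (n : ℕ) : Prop := ∃ k, f^[k] n = 1

namespace ReachesOne

variable {f : ℕ → ℕ}

theorem one : ReachesOne f 1 := ⟨0, rfl⟩

theorem not_zero (hf0 : f 0 = 0) : ¬ ReachesOne f 0 := by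
  rintro ⟨k, hk⟩
  rw [Function.iterate_fixed hf0] at hk
  exact zero_ne_one hk

theorem apply_iff (hf1 : f 1 = 1) (n : ℕ) : ReachesOne f (f n) ↔ ReachesOne f n := by
  constructor
  · rintro ⟨k, hk⟩
    exact ⟨k + 1, hk⟩
  · rintro ⟨k, hk⟩
    refine ⟨k, ?_⟩
    rw [← Function.iterate_succ_apply, Function.iterate_succ_apply', hk, hf1]

end ReachesOne

theorem apply_lt_self_of_multiplicative {f : ℕ → ℕ}
    (hmul : ∀ m n : ℕ, Nat.Coprime m n → f (m * n) = f m * f n)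
    (hI : ∀ p α : ℕ, p.Prime → 1 ≤ α → f (p ^ α) < p ^ α) {n : ℕ} (hn : 1 < n) :
    f n < n := by
  induction n using Nat.recOnPosPrimePosCoprime with
  | prime_pow p α hp hα => exact hI p α hp hα
  | zero => omega
  | one => omega
  | coprime a b ha hb hab iha ihb =>
    rw [hmul a b hab]
    exact Nat.mul_lt_mul'' (iha ha) (ihb hb)

theorem apply_prime_dvd_apply {f : ℕ → ℕ} (hf0 : f 0 = 0)
    (hmul : ∀ m n : ℕ, Nat.Coprime m n → f (m * n) = f m * f n)
    (hII : ∀ p α : ℕ, p.Prime → 1 ≤ α → f p ∣ f (p ^ α))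
    {p n : ℕ} (hp : p.Prime) (hpn : p ∣ n) : f p ∣ f n := by
  rcases eq_or_ne n 0 with rfl | hn
  · simp [hf0]
  · obtain ⟨α, m, hm, rfl⟩ := Nat.exists_eq_pow_mul_and_not_dvd hn p hp.ne_one
    have hα : 1 ≤ α := by
      by_contra h
      obtain rfl : α = 0 := by omega
      simp_all
    rw [hmul _ _ (((Nat.Prime.coprime_iff_not_dvd hp).2 hm).pow_left α)]
    exact (hII p α hp hα).mul_right _

theorem dvd_or_exists_dvd_apply_prime {f : ℕ → ℕ} (hf1 : f 1 = 1)
    (hmul : ∀ m n : ℕ, Nat.Coprime m n → f (m * n) = f m * f n)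
    (hIII : ∀ p α q : ℕ, p.Prime → 1 ≤ α → q.Prime → q ∣ f (p ^ α) → q ∣ p * f p)
    {n q : ℕ} (hn : n ≠ 0) (hq : q.Prime) (hqn : q ∣ f n) :
    q ∣ n ∨ ∃ p, p.Prime ∧ p ∣ n ∧ q ∣ f p := by
  induction n using Nat.recOnPosPrimePosCoprime with
  | prime_pow p α hp hα =>
    have hpα : p ∣ p ^ α := dvd_pow_self p (Nat.ne_of_gt hα)
    rcases (hq.dvd_mul).1 (hIII p α q hp hα hq hqn) with h | h
    · exact Or.inl (h.trans hpα)
    · exact Or.inr ⟨p, hp, hpα, h⟩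
  | zero => exact absurd rfl hn
  | one => exact absurd (hf1 ▸ hqn) hq.not_dvd_one
  | coprime a b ha hb hab iha ihb =>
    rw [hmul a b hab] at hqn
    rcases (hq.dvd_mul).1 hqn with h | h
    · rcases iha (by omega) h with h | ⟨p, hp, hpa, h⟩
      · exact Or.inl (h.mul_right b)
      · exact Or.inr ⟨p, hp, hpa.mul_right b, h⟩
    · rcases ihb (by omega) h with h | ⟨p, hp, hpb, h⟩
      · exact Or.inl (h.mul_left a)
      · exact Or.inr ⟨p, hp, hpb.mul_left a, h⟩

theorem exists_prime_apply_eq_zero {f : ℕ → ℕ} (hf1 : f 1 = 1)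
    (hmul : ∀ m n : ℕ, Nat.Coprime m n → f (m * n) = f m * f n)
    (hIII : ∀ p α q : ℕ, p.Prime → 1 ≤ α → q.Prime → q ∣ f (p ^ α) → q ∣ p * f p)
    {n : ℕ} (hn : n ≠ 0) (hfn : f n = 0) : ∃ p, p.Prime ∧ p ∣ n ∧ f p = 0 := by
  induction n using Nat.recOnPosPrimePosCoprime with
  | prime_pow p α hp hα =>
    refine ⟨p, hp, dvd_pow_self p (Nat.ne_of_gt hα), ?_⟩
    by_contra hfp
    obtain ⟨q, hq, hqp⟩ := Nat.exists_infinite_primes (p * f p + 1)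
    have hdvd := hIII p α q hp hα hqp (hfn ▸ dvd_zero q)
    have := Nat.le_of_dvd (Nat.mul_pos hp.pos (Nat.pos_of_ne_zero hfp)) hdvd
    omega
  | zero => exact absurd rfl hn
  | one => omega
  | coprime a b ha hb hab iha ihb =>
    rw [hmul a b hab] at hfn
    rcases Nat.mul_eq_zero.1 hfn with h | h
    · obtain ⟨p, hp, hpa, h⟩ := iha (by omega) h
      exact ⟨p, hp, hpa.mul_right b, h⟩
    · obtain ⟨p, hp, hpb, h⟩ := ihb (by omega) h
      exact ⟨p, hp, hpb.mul_left a, h⟩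

theorem reachesOne_iff_forall_prime {f : ℕ → ℕ} (hf0 : f 0 = 0) (hf1 : f 1 = 1)
    (hmul : ∀ m n : ℕ, Nat.Coprime m n → f (m * n) = f m * f n)
    (hI : ∀ p α : ℕ, p.Prime → 1 ≤ α → f (p ^ α) < p ^ α)
    (hII : ∀ p α : ℕ, p.Prime → 1 ≤ α → f p ∣ f (p ^ α))
    (hIII : ∀ p α q : ℕ, p.Prime → 1 ≤ α → q.Prime → q ∣ f (p ^ α) → q ∣ p * f p)
    (n : ℕ) : ReachesOne f n ↔ n ≠ 0 ∧ ∀ p, p.Prime → p ∣ n → ReachesOne f p := by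
  induction n using Nat.strong_induction_on with
  | _ n ih =>
  have hlt {k : ℕ} (hk : 1 < k) : f k < k := apply_lt_self_of_multiplicative hmul hI hk
  rcases Nat.lt_or_ge 1 n with hn | hn
  · have hn0 : n ≠ 0 := by omega
    have ih_prime {p : ℕ} (hp : p.Prime) (hpn : p ∣ n) :=
      ih (f p) ((hlt hp.one_lt).trans_le (Nat.le_of_dvd (by omega) hpn))
    rw [← ReachesOne.apply_iff hf1, ih (f n) (hlt hn)]
    constructor
    · rintro ⟨hfn, h⟩
      refine ⟨hn0, fun p hp hpn => ?_⟩
      have hdvd := apply_prime_dvd_apply hf0 hmul hII hp hpn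
      rw [← ReachesOne.apply_iff hf1, ih_prime hp hpn]
      exact ⟨fun h0 => hfn (zero_dvd_iff.1 (h0 ▸ hdvd)), fun q hq hqp => h q hq (hqp.trans hdvd)⟩
    · rintro ⟨-, h⟩
      have h' {p : ℕ} (hp : p.Prime) (hpn : p ∣ n) :=
        (ih_prime hp hpn).1 ((ReachesOne.apply_iff hf1 p).2 (h p hp hpn))
      refine ⟨fun hfn => ?_, fun q hq hqn => ?_⟩
      · obtain ⟨p, hp, hpn, hfp⟩ := exists_prime_apply_eq_zero hf1 hmul hIII hn0 hfn
        exact (h' hp hpn).1 hfp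
      · rcases dvd_or_exists_dvd_apply_prime hf1 hmul hIII hn0 hq hqn with hd | ⟨p, hp, hpn, hd⟩
        · exact h q hq hd
        · exact (h' hp hpn).2 q hq hd
  · obtain rfl | rfl : n = 0 ∨ n = 1 := by omega
    · simp [ReachesOne.not_zero hf0]
    · simp only [ReachesOne.one, true_iff]
      exact ⟨one_ne_zero, fun p hp h => absurd h hp.not_dvd_one⟩

open Classical in
theorem iterate_eq_ite_reachesOne {f : ℕ → ℕ} (hf0 : f 0 = 0) (hf1 : f 1 = 1)
    (hlt : ∀ n, 1 < n → f n < n) {m n : ℕ} (hnm : n ≤ m) :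
    f^[m] n = if ReachesOne f n then 1 else 0 := by
  induction m generalizing n with
  | zero =>
    obtain rfl : n = 0 := by omega
    simp [ReachesOne.not_zero hf0]
  | succ m ih =>
    rcases Nat.lt_or_ge 1 n with hn | hn
    · have := hlt n hn
      rw [Function.iterate_succ_apply, ih (by omega)]
      simp only [ReachesOne.apply_iff hf1]
    · obtain rfl | rfl : n = 0 ∨ n = 1 := by omega
      · rw [Function.iterate_fixed hf0, if_neg (ReachesOne.not_zero hf0)]
      · rw [Function.iterate_fixed hf1, if_pos ReachesOne.one]

theorem stmt0 (f : ℕ → ℕ) (hf0 : f 0 = 0) (hf1 : f 1 = 1)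
    (hmul : ∀ m n : ℕ, Nat.Coprime m n → f (m * n) = f m * f n)
    (hI : ∀ p α : ℕ, p.Prime → 1 ≤ α → f (p ^ α) < p ^ α)
    (hII : ∀ p α : ℕ, p.Prime → 1 ≤ α → f p ∣ f (p ^ α))
    (hIII : ∀ p α q : ℕ, p.Prime → 1 ≤ α → q.Prime → q ∣ f (p ^ α) → q ∣ p * f p) :
    f^[1] 1 = 1 ∧
      ∀ m n : ℕ, 0 < m → 0 < n → f^[m * n] (m * n) = f^[m] m * f^[n] n := by
  classical
  refine ⟨hf1, fun m n _ _ => ?_⟩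
  have hlt (k : ℕ) (hk : 1 < k) : f k < k := apply_lt_self_of_multiplicative hmul hI hk
  have key := reachesOne_iff_forall_prime hf0 hf1 hmul hI hII hIII
  have hiff : ReachesOne f (m * n) ↔ ReachesOne f m ∧ ReachesOne f n := by
    rw [key (m * n), key m, key n]
    constructor
    · rintro ⟨h0, h⟩
      exact ⟨⟨left_ne_zero_of_mul h0, fun p hp hd => h p hp (hd.mul_right n)⟩,
        right_ne_zero_of_mul h0, fun p hp hd => h p hp (hd.mul_left m)⟩
    · rintro ⟨⟨hm0, hm⟩, hn0, hn⟩
      exact ⟨mul_ne_zero hm0 hn0, fun p hp hd => ((hp.dvd_mul).1 hd).elim (hm p hp) (hn p hp)⟩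
  simp only [iterate_eq_ite_reachesOne hf0 hf1 hlt le_rfl, hiff, ite_and, ite_mul, one_mul,
    zero_mul]
end

section
/- If k is a positive integer all of whose prime divisors belong to T, then every positive divisor of k (including k itself) belongs to T. -/
theorem stmt1 (f : ℕ → ℕ) (hf0 : f 0 = 0) (hf1 : f 1 = 1)
    (hmul : ∀ m n : ℕ, Nat.Coprime m n → f (m * n) = f m * f n)
    (hI : ∀ p α : ℕ, p.Prime → 1 ≤ α → f (p ^ α) < p ^ α)
    (hII : ∀ p α : ℕ, p.Prime → 1 ≤ α → f p ∣ f (p ^ α))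
    (hIII : ∀ p α q : ℕ, p.Prime → 1 ≤ α → q.Prime → q ∣ f (p ^ α) → q ∣ p * f p)
    (T : Set ℕ) (hTpos : ∀ n ∈ T, 0 < n) (hT1 : (1 : ℕ) ∈ T)
    (hTprime : ∀ p : ℕ, p.Prime → (p ∈ T ↔ f p ∈ T))
    (hTcomp : ∀ x : ℕ, 1 < x → ¬x.Prime →
      (x ∈ T ↔ ∃ a b : ℕ, a ∈ T ∧ b ∈ T ∧ 1 < a ∧ 1 < b ∧ a * b = x))
    (k : ℕ) (hk : 0 < k) (hprimes : ∀ p : ℕ, p.Prime → p ∣ k → p ∈ T) :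
    ∀ d : ℕ, d ∣ k → d ∈ T := by
  intro d
  induction d using induction_on_primes with
  | zero => exact fun h => absurd (Nat.eq_zero_of_zero_dvd h) hk.ne'
  | one => exact fun _ => hT1
  | prime_mul p a hp ih =>
    intro h
    have hpT : p ∈ T := hprimes p hp (dvd_of_mul_right_dvd h)
    have haT : a ∈ T := ih (dvd_of_mul_left_dvd h)
    rcases (Nat.succ_le_of_lt (hTpos a haT)).eq_or_lt with ha | ha
    · simpa [← ha] using hpT
    · exact (hTcomp (p * a) (one_lt_mul'' hp.one_lt ha)
        (Nat.not_prime_mul hp.ne_one ha.ne')).mpr ⟨p, a, hpT, haT, hp.one_lt, ha, rfl⟩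
end

section
/- If a positive integer k belongs to T, then every positive divisor of k belongs to T. -/
theorem stmt2 (f : ℕ → ℕ) (hf0 : f 0 = 0) (hf1 : f 1 = 1)
    (hmul : ∀ m n : ℕ, Nat.Coprime m n → f (m * n) = f m * f n)
    (hI : ∀ p α : ℕ, p.Prime → 1 ≤ α → f (p ^ α) < p ^ α)
    (hII : ∀ p α : ℕ, p.Prime → 1 ≤ α → f p ∣ f (p ^ α))
    (hIII : ∀ p α q : ℕ, p.Prime → 1 ≤ α → q.Prime → q ∣ f (p ^ α) → q ∣ p * f p)
    (T : Set ℕ) (hTpos : ∀ n ∈ T, 0 < n) (hT1 : (1 : ℕ) ∈ T)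
    (hTprime : ∀ p : ℕ, p.Prime → (p ∈ T ↔ f p ∈ T))
    (hTcomp : ∀ x : ℕ, 1 < x → ¬x.Prime →
      (x ∈ T ↔ ∃ a b : ℕ, a ∈ T ∧ b ∈ T ∧ 1 < a ∧ 1 < b ∧ a * b = x))
    (k : ℕ) (hk : 0 < k) (hkT : k ∈ T) :
    ∀ d : ℕ, d ∣ k → d ∈ T := by
  have mul_mem : ∀ a ∈ T, ∀ b ∈ T, a * b ∈ T := by
    intro a ha b hb
    rcases (Nat.succ_le_of_lt (hTpos a ha)).eq_or_lt with rfl | ha1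
    · simpa using hb
    rcases (Nat.succ_le_of_lt (hTpos b hb)).eq_or_lt with rfl | hb1
    · simpa using ha
    exact (hTcomp (a * b) (one_lt_mul'' ha1 hb1)
      (Nat.not_prime_mul (by omega) (by omega))).2 ⟨a, b, ha, hb, ha1, hb1, rfl⟩
  induction k using Nat.strong_induction_on with
  | _ k ih =>
    intro d hd
    by_cases hp : k.Prime
    · rcases (Nat.dvd_prime hp).1 hd with rfl | rfl
      · exact hT1
      · exact hkT
    rcases (Nat.succ_le_of_lt hk).eq_or_lt with rfl | hk1
    · rwa [Nat.dvd_one.1 hd]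
    obtain ⟨a, b, ha, hb, ha1, hb1, rfl⟩ := (hTcomp k hk1 hp).1 hkT
    obtain ⟨x, y, hx, hy, rfl⟩ := exists_dvd_and_dvd_of_dvd_mul hd
    exact mul_mem x (ih a (by nlinarith) (by omega) ha x hx)
      y (ih b (by nlinarith) (by omega) hb y hy)
end

section
/- For all positive integers k and r, the r-th iterate f^r(k) belongs to S if and only if k belongs to S. -/
/-- A multiplicative function lying strictly below the identity at prime powers lies strictly
below the identity at all `n > 1`. -/
theorem multiplicative_lt_self {f : ℕ → ℕ}
    (hmul : ∀ m n : ℕ, Nat.Coprime m n → f (m * n) = f m * f n)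
    (hI : ∀ p α : ℕ, p.Prime → 1 ≤ α → f (p ^ α) < p ^ α) (n : ℕ) : 1 < n → f n < n := by
  induction n using Nat.recOnPosPrimePosCoprime with
  | prime_pow p a hp ha => exact fun _ => hI p a hp ha
  | zero => simp
  | one => simp
  | coprime a b ha hb hab iha ihb =>
    intro _
    rw [hmul a b hab]
    exact mul_lt_mul'' (iha ha) (ihb hb) (Nat.zero_le _) (Nat.zero_le _)

/-- A prime dividing `f n`, for `f` multiplicative, divides `f` of some prime power whose base
divides `n`. -/
theorem exists_prime_pow_of_prime_dvd_multiplicative {f : ℕ → ℕ} (hf1 : f 1 = 1)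
    (hmul : ∀ m n : ℕ, Nat.Coprime m n → f (m * n) = f m * f n) {q : ℕ} (hq : q.Prime) (n : ℕ) :
    0 < n → q ∣ f n → ∃ p a : ℕ, p.Prime ∧ 1 ≤ a ∧ p ∣ n ∧ q ∣ f (p ^ a) := by
  induction n using Nat.recOnPosPrimePosCoprime with
  | prime_pow p a hp ha => exact fun _ h => ⟨p, a, hp, ha, dvd_pow_self p ha.ne', h⟩
  | zero => simp
  | one => simp [hf1, hq.ne_one]
  | coprime a b ha hb hab iha ihb =>
    intro _ h
    rw [hmul a b hab] at h
    rcases hq.dvd_mul.1 h with h | h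
    · obtain ⟨p, e, hp, he, hpa, hqp⟩ := iha (by lia) h
      exact ⟨p, e, hp, he, hpa.mul_right b, hqp⟩
    · obtain ⟨p, e, hp, he, hpb, hqp⟩ := ihb (by lia) h
      exact ⟨p, e, hp, he, hpb.mul_left a, hqp⟩

/-- A zero of a multiplicative function comes from a zero at a prime power. -/
theorem exists_prime_pow_of_multiplicative_eq_zero {f : ℕ → ℕ} (hf1 : f 1 = 1)
    (hmul : ∀ m n : ℕ, Nat.Coprime m n → f (m * n) = f m * f n) (n : ℕ) :
    0 < n → f n = 0 → ∃ p a : ℕ, p.Prime ∧ 1 ≤ a ∧ p ∣ n ∧ f (p ^ a) = 0 := by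
  induction n using Nat.recOnPosPrimePosCoprime with
  | prime_pow p a hp ha => exact fun _ h => ⟨p, a, hp, ha, dvd_pow_self p ha.ne', h⟩
  | zero => simp
  | one => simp [hf1]
  | coprime a b ha hb hab iha ihb =>
    intro _ h
    rw [hmul a b hab] at h
    rcases mul_eq_zero.1 h with h | h
    · obtain ⟨p, e, hp, he, hpa, h0⟩ := iha (by lia) h
      exact ⟨p, e, hp, he, hpa.mul_right b, h0⟩
    · obtain ⟨p, e, hp, he, hpb, h0⟩ := ihb (by lia) h
      exact ⟨p, e, hp, he, hpb.mul_left a, h0⟩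

/-- If `f p ∣ f (p ^ a)` at prime powers and `f` is multiplicative, then `f p ∣ f n` for every
prime factor `p` of `n`. -/
theorem multiplicative_prime_dvd {f : ℕ → ℕ}
    (hmul : ∀ m n : ℕ, Nat.Coprime m n → f (m * n) = f m * f n)
    (hII : ∀ p α : ℕ, p.Prime → 1 ≤ α → f p ∣ f (p ^ α))
    {p n : ℕ} (hn : n ≠ 0) (hp : p.Prime) (hpn : p ∣ n) : f p ∣ f n := by
  obtain ⟨a, m, hm, rfl⟩ := Nat.exists_eq_pow_mul_and_not_dvd hn p hp.ne_one
  have ha : 1 ≤ a := by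
    rcases Nat.eq_zero_or_pos a with rfl | ha
    · simp [hm] at hpn
    · exact ha
  rw [hmul _ _ (((Nat.Prime.coprime_iff_not_dvd hp).2 hm).pow_left a)]
  exact (hII p a hp ha).mul_right _

/-- The forward orbit of `n` under `f` contains `0`. -/
def OrbitMeetsZero (f : ℕ → ℕ) (n : ℕ) : Prop := ∃ j, f^[j] n = 0

theorem orbitMeetsZero_zero (f : ℕ → ℕ) : OrbitMeetsZero f 0 := ⟨0, rfl⟩

theorem orbitMeetsZero_apply_iff {f : ℕ → ℕ} (hf0 : f 0 = 0) (n : ℕ) :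
    OrbitMeetsZero f (f n) ↔ OrbitMeetsZero f n := by
  constructor
  · rintro ⟨j, hj⟩
    exact ⟨j + 1, by rwa [Function.iterate_succ_apply]⟩
  · rintro ⟨j, hj⟩
    exact ⟨j, by rw [← Function.iterate_succ_apply, Function.iterate_succ_apply', hj, hf0]⟩

theorem orbitMeetsZero_iterate_iff {f : ℕ → ℕ} (hf0 : f 0 = 0) (n r : ℕ) :
    OrbitMeetsZero f (f^[r] n) ↔ OrbitMeetsZero f n := by
  induction r with
  | zero => rfl
  | succ r ih => rw [Function.iterate_succ_apply', orbitMeetsZero_apply_iff hf0, ih]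

theorem not_orbitMeetsZero_one {f : ℕ → ℕ} (hf1 : f 1 = 1) : ¬OrbitMeetsZero f 1 := by
  rintro ⟨j, hj⟩
  rw [Function.iterate_fixed hf1] at hj
  exact one_ne_zero hj

/-- If `f` decreases every `n > 1`, then `n` iterations decide whether the orbit of `n`
meets `0`. -/
theorem iterate_self_eq_zero_iff {f : ℕ → ℕ} (hf0 : f 0 = 0) (hf1 : f 1 = 1)
    (hlt : ∀ n, 1 < n → f n < n) (n : ℕ) : f^[n] n = 0 ↔ OrbitMeetsZero f n := by
  refine ⟨fun h => ⟨n, h⟩, ?_⟩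
  induction n using Nat.strong_induction_on with
  | _ n ih =>
    intro h
    rcases Nat.lt_or_ge 1 n with hn | hn
    · have h0 := ih (f n) (hlt n hn) ((orbitMeetsZero_apply_iff hf0 n).2 h)
      obtain ⟨d, hd⟩ := Nat.exists_eq_add_of_lt (hlt n hn)
      have hd' : n = d + (f n + 1) := by lia
      calc f^[n] n = f^[d + (f n + 1)] n := by rw [← hd']
        _ = 0 := by
          rw [Function.iterate_add_apply, Function.iterate_succ_apply, h0,
            Function.iterate_fixed hf0]
    · interval_cases n
      · rfl
      · exact absurd h (not_orbitMeetsZero_one hf1)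

/-- The orbit of a positive integer avoids `0` exactly when the orbits of all its prime factors
do. -/
theorem not_orbitMeetsZero_iff_forall_prime {f : ℕ → ℕ} (hf0 : f 0 = 0) (hf1 : f 1 = 1)
    (hmul : ∀ m n : ℕ, Nat.Coprime m n → f (m * n) = f m * f n)
    (hI : ∀ p α : ℕ, p.Prime → 1 ≤ α → f (p ^ α) < p ^ α)
    (hII : ∀ p α : ℕ, p.Prime → 1 ≤ α → f p ∣ f (p ^ α))
    (hIII : ∀ p α q : ℕ, p.Prime → 1 ≤ α → q.Prime → q ∣ f (p ^ α) → q ∣ p * f p)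
    (n : ℕ) (hn : 0 < n) :
    ¬OrbitMeetsZero f n ↔ ∀ q : ℕ, q.Prime → q ∣ n → ¬OrbitMeetsZero f q := by
  have hpos : ∀ m, ¬OrbitMeetsZero f m → 0 < m := fun m hm =>
    Nat.pos_of_ne_zero fun h => hm (h ▸ orbitMeetsZero_zero f)
  induction n using Nat.strong_induction_on with
  | _ n ih =>
    rcases Nat.eq_or_lt_of_le (Nat.succ_le_of_lt hn) with h1 | h1
    · obtain rfl : n = 1 := h1.symm
      refine iff_of_true (not_orbitMeetsZero_one hf1) fun q hq hq1 => ?_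
      exact absurd (Nat.dvd_one.1 hq1) hq.ne_one
    have hlt := multiplicative_lt_self hmul hI
    have hflt : ∀ p : ℕ, p.Prime → p ∣ n → f p < n := fun p hp hpn =>
      (hlt p hp.one_lt).trans_le (Nat.le_of_dvd hn hpn)
    rw [← orbitMeetsZero_apply_iff hf0]
    constructor
    · intro h p hp hpn
      have hfn := hpos _ h
      have hdvd := multiplicative_prime_dvd hmul hII hn.ne' hp hpn
      rw [← orbitMeetsZero_apply_iff hf0]
      refine (ih (f p) (hflt p hp hpn) (Nat.pos_of_dvd_of_pos hdvd hfn)).2 ?_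
      exact fun q hq hqp => (ih (f n) (hlt n h1) hfn).1 h q hq (hqp.trans hdvd)
    · intro h
      have hp_apply : ∀ p : ℕ, p.Prime → p ∣ n → ¬OrbitMeetsZero f (f p) := fun p hp hpn => by
        rw [orbitMeetsZero_apply_iff hf0]
        exact h p hp hpn
      have hfn : 0 < f n := by
        refine Nat.pos_of_ne_zero fun h0 => ?_
        obtain ⟨p, a, hp, ha, hpn, hpa⟩ :=
          exists_prime_pow_of_multiplicative_eq_zero hf1 hmul n hn h0
        have hfp := hpos _ (hp_apply p hp hpn)
        obtain ⟨q, hq_lt, hq⟩ := Nat.exists_infinite_primes (p * f p + 1)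
        have hle := Nat.le_of_dvd (Nat.mul_pos hp.pos hfp)
          (hIII p a q hp ha hq (hpa ▸ dvd_zero q))
        lia
      refine (ih (f n) (hlt n h1) hfn).2 ?_
      intro q hq hqn
      obtain ⟨p, a, hp, ha, hpn, hqp⟩ :=
        exists_prime_pow_of_prime_dvd_multiplicative hf1 hmul hq n hn hqn
      rcases hq.dvd_mul.1 (hIII p a q hp ha hq hqp) with hqp | hqp
      · exact h q hq (hqp.trans hpn)
      · have hfp := hp_apply p hp hpn
        exact (ih (f p) (hflt p hp hpn) (hpos _ hfp)).1 hfp q hq hqp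

theorem stmt5 (f : ℕ → ℕ) (hf0 : f 0 = 0) (hf1 : f 1 = 1)
    (hmul : ∀ m n : ℕ, Nat.Coprime m n → f (m * n) = f m * f n)
    (hI : ∀ p α : ℕ, p.Prime → 1 ≤ α → f (p ^ α) < p ^ α)
    (hII : ∀ p α : ℕ, p.Prime → 1 ≤ α → f p ∣ f (p ^ α))
    (hIII : ∀ p α q : ℕ, p.Prime → 1 ≤ α → q.Prime → q ∣ f (p ^ α) → q ∣ p * f p) :
    ∀ k r : ℕ, 0 < k → 0 < r →
      ((1 ≤ f^[r] k ∧ ∀ q : ℕ, q.Prime → f^[q] q = 0 → ¬q ∣ f^[r] k) ↔ (1 ≤ k ∧ ∀ q : ℕ, q.Prime → f^[q] q = 0 → ¬q ∣ k)) := by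
  have hS : ∀ n : ℕ, (1 ≤ n ∧ ∀ q : ℕ, q.Prime → f^[q] q = 0 → ¬q ∣ n) ↔
      ¬OrbitMeetsZero f n := by
    intro n
    rcases Nat.eq_zero_or_pos n with rfl | hn
    · simp [orbitMeetsZero_zero]
    · rw [not_orbitMeetsZero_iff_forall_prime hf0 hf1 hmul hI hII hIII n hn]
      simp only [iterate_self_eq_zero_iff hf0 hf1 (multiplicative_lt_self hmul hI)]
      exact ⟨fun h q hq hqn h0 => h.2 q hq h0 hqn, fun h => ⟨hn, fun q hq h0 hqn => h q hq hqn h0⟩⟩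
  intro k r _ _
  rw [hS, hS, orbitMeetsZero_iterate_iff hf0]
end

section
/- For every positive integer n, the n-th iterate of f applied to n lies in {0, 1}: f^n(n) = 0 or f^n(n) = 1. -/
/-- A function multiplicative on coprime arguments and strictly below the identity on prime powers
is strictly below the identity on every integer greater than one. -/
theorem lt_self_of_lt_self_prime_pow (f : ℕ → ℕ)
    (hmul : ∀ m n : ℕ, Nat.Coprime m n → f (m * n) = f m * f n)
    (hpow : ∀ p α : ℕ, p.Prime → 1 ≤ α → f (p ^ α) < p ^ α) (n : ℕ) (hn : 1 < n) :
    f n < n := by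
  induction n using Nat.recOnPosPrimePosCoprime with
  | prime_pow p α hp hα => exact hpow p α hp hα
  | zero => omega
  | one => omega
  | coprime a b ha hb hab iha ihb =>
    rw [hmul a b hab]
    exact Nat.mul_lt_mul'' (iha ha) (ihb hb)

/-- If `f` strictly decreases every integer greater than one and preserves `{0, 1}`, then
`k ≥ n - 1` iterations bring `n` into `{0, 1}`. -/
theorem iterate_le_one_of_lt_self (f : ℕ → ℕ) (hf0 : f 0 ≤ 1) (hf1 : f 1 ≤ 1)
    (hlt : ∀ n, 1 < n → f n < n) (k n : ℕ) (hnk : n ≤ k + 1) : f^[k] n ≤ 1 := by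
  induction k generalizing n with
  | zero => simpa using hnk
  | succ k ih =>
    rw [Function.iterate_succ_apply]
    apply ih
    rcases Nat.lt_or_ge 1 n with hn | hn
    · have := hlt n hn
      omega
    · interval_cases n <;> omega

theorem stmt7 (f : ℕ → ℕ) (hf0 : f 0 = 0) (hf1 : f 1 = 1)
    (hmul : ∀ m n : ℕ, Nat.Coprime m n → f (m * n) = f m * f n)
    (hI : ∀ p α : ℕ, p.Prime → 1 ≤ α → f (p ^ α) < p ^ α)
    (hII : ∀ p α : ℕ, p.Prime → 1 ≤ α → f p ∣ f (p ^ α))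
    (hIII : ∀ p α q : ℕ, p.Prime → 1 ≤ α → q.Prime → q ∣ f (p ^ α) → q ∣ p * f p) :
    ∀ n : ℕ, 0 < n → f^[n] n = 0 ∨ f^[n] n = 1 := by
  intro n _
  exact Nat.le_one_iff_eq_zero_or_eq_one.mp <|
    iterate_le_one_of_lt_self f (by omega) (by omega)
      (lt_self_of_lt_self_prime_pow f hmul hI) n n (by omega)
end

section
/- If n is a positive integer all of whose prime divisors lie in T, then every prime divisor of f(n) lies in T. -/
/-- If membership of a composite number in `T` forces a nontrivial factorization inside `T`, then `T`
is closed under taking prime divisors. -/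
theorem prime_mem_of_dvd_mem {T : Set ℕ} (hTpos : ∀ n ∈ T, 0 < n)
    (hTcomp : ∀ x : ℕ, 1 < x → ¬x.Prime → x ∈ T →
      ∃ a b : ℕ, a ∈ T ∧ b ∈ T ∧ 1 < a ∧ 1 < b ∧ a * b = x)
    {q : ℕ} (hq : q.Prime) (x : ℕ) (hx : x ∈ T) (hqx : q ∣ x) : q ∈ T := by
  induction x using Nat.strong_induction_on with
  | _ x ih =>
    by_cases hxp : x.Prime
    · rwa [(Nat.prime_dvd_prime_iff_eq hq hxp).1 hqx]
    · have hx1 : 1 < x := hq.one_lt.trans_le (Nat.le_of_dvd (hTpos x hx) hqx)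
      obtain ⟨a, b, ha, hb, ha1, hb1, rfl⟩ := hTcomp x hx1 hxp hx
      rcases hq.dvd_mul.1 hqx with h | h
      · exact ih a (by nlinarith) ha h
      · exact ih b (by nlinarith) hb h


theorem stmt12 (f : ℕ → ℕ) (hf0 : f 0 = 0) (hf1 : f 1 = 1)
    (hmul : ∀ m n : ℕ, Nat.Coprime m n → f (m * n) = f m * f n)
    (hI : ∀ p α : ℕ, p.Prime → 1 ≤ α → f (p ^ α) < p ^ α)
    (hII : ∀ p α : ℕ, p.Prime → 1 ≤ α → f p ∣ f (p ^ α))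
    (hIII : ∀ p α q : ℕ, p.Prime → 1 ≤ α → q.Prime → q ∣ f (p ^ α) → q ∣ p * f p)
    (T : Set ℕ) (hTpos : ∀ n ∈ T, 0 < n) (hT1 : (1 : ℕ) ∈ T)
    (hTprime : ∀ p : ℕ, p.Prime → (p ∈ T ↔ f p ∈ T))
    (hTcomp : ∀ x : ℕ, 1 < x → ¬x.Prime →
      (x ∈ T ↔ ∃ a b : ℕ, a ∈ T ∧ b ∈ T ∧ 1 < a ∧ 1 < b ∧ a * b = x))
    (n : ℕ) (hn : 0 < n) (hprimes : ∀ p : ℕ, p.Prime → p ∣ n → p ∈ T) :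
    ∀ q : ℕ, q.Prime → q ∣ f n → q ∈ T := by
  induction n using Nat.recOnPosPrimePosCoprime with
  | zero => exact absurd hn (lt_irrefl 0)
  | one =>
    intro q hq hqf
    rw [hf1] at hqf
    exact absurd hqf hq.not_dvd_one
  | prime_pow p k hp hk =>
    intro q hq hqf
    have hpT : p ∈ T := hprimes p hp (dvd_pow_self p hk.ne')
    rcases hq.dvd_mul.1 (hIII p k q hp hk hq hqf) with h | h
    · rwa [(Nat.prime_dvd_prime_iff_eq hq hp).1 h]
    · exact prime_mem_of_dvd_mem hTpos (fun x hx hxp => (hTcomp x hx hxp).1) hq (f p)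
        ((hTprime p hp).1 hpT) h
  | coprime a b ha hb hab iha ihb =>
    intro q hq hqf
    rw [hmul a b hab] at hqf
    rcases hq.dvd_mul.1 hqf with h | h
    · exact iha (by lia) (fun p hp hpa => hprimes p hp (hpa.mul_right b)) q hq h
    · exact ihb (by lia) (fun p hp hpb => hprimes p hp (hpb.mul_left a)) q hq h
end
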